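/- arXiv:1310.1376 — 2 statements merged into one kernel-verified Lean document; each statement's English description precedes it below -/
import Mathlib

section
/- In a finite graph, let P1 and P2 be two paths with tails R1 and R2 respectively, such that R1 and P2 are vertex-disjoint and R2 and P1 are vertex-disjoint. If there exists a path P such that the vertex set of P intersects P1 in a nonempty set contained in R1, and intersects P2 in a nonempty set contained in R2, then P1 and P2 cannot both be longest paths. -/
open SimpleGraph

namespace SimpleGraph.Walk

/-- `R` is a prefix of the walk `P`. -/
def IsPrefixOf {V : Type*} {G : SimpleGraph V} {u v w x : V}
    (R : G.Walk u v) (P : G.Walk w x) : Prop :=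
  ∃ (hu : u = w) (Q : G.Walk v x), P = (R.copy hu rfl).append Q

/-- `R` is a suffix of the walk `P`. -/
def IsSuffixOf {V : Type*} {G : SimpleGraph V} {u v w x : V}
    (R : G.Walk u v) (P : G.Walk w x) : Prop :=
  ∃ (hv : v = x) (Q : G.Walk w u), P = Q.append (R.copy rfl hv)

/-- `R` is a tail of `P`: a subpath of `P` containing an endpoint of `P`
(up to orientation). -/
def IsTailOf {V : Type*} {G : SimpleGraph V} {u v w x : V}
    (R : G.Walk u v) (P : G.Walk w x) : Prop :=
  R.IsPrefixOf P ∨ R.IsSuffixOf P ∨ R.reverse.IsPrefixOf P ∨ R.reverse.IsSuffixOf P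

/-- `R` is an infix of the walk `P`. -/
def IsInfixOf {V : Type*} {G : SimpleGraph V} {u v w x : V}
    (R : G.Walk u v) (P : G.Walk w x) : Prop :=
  ∃ (Q₁ : G.Walk w u) (Q₂ : G.Walk v x), P = Q₁.append (R.append Q₂)

/-- `R` is a subpath of `P` (an infix, up to orientation). -/
def IsSubpathOf {V : Type*} {G : SimpleGraph V} {u v w x : V}
    (R : G.Walk u v) (P : G.Walk w x) : Prop :=
  R.IsInfixOf P ∨ R.reverse.IsInfixOf P

/-- `R` is one of the two tails of `P` obtained by splitting `P` at the vertex `z`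
(up to orientation). -/
def IsTailFrom {V : Type*} {G : SimpleGraph V} (z : V) {u v w x : V}
    (R : G.Walk u v) (P : G.Walk w x) : Prop :=
  (R.IsPrefixOf P ∧ v = z) ∨ (R.IsSuffixOf P ∧ u = z) ∨
  (R.reverse.IsPrefixOf P ∧ u = z) ∨ (R.reverse.IsSuffixOf P ∧ v = z)

end SimpleGraph.Walk

/-- A walk `p` is a longest path in `G` if it is a path and no path in `G` is longer. -/
def IsLongestPath {V : Type*} (G : SimpleGraph V) {a b : V} (p : G.Walk a b) : Prop :=
  p.IsPath ∧ ∀ (c d : V) (q : G.Walk c d), q.IsPath → q.length ≤ p.length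

theorem aux_append {V : Type*} {G : SimpleGraph V} {a b c : V} (p : G.Walk a b) (q : G.Walk b c)
    (hp : p.IsPath) (hq : q.IsPath) (h : ∀ z, z ∈ p.support → z ∈ q.support → z = b) :
    (p.append q).IsPath := by
  rw [Walk.isPath_def, Walk.support_append, List.nodup_append]
  have hq' := hq.support_nodup
  rw [Walk.support_eq_cons, List.nodup_cons] at hq'
  refine ⟨hp.support_nodup, hq'.2, ?_⟩
  intro x hx y hy hxy
  subst hxy
  have := h x hx (List.mem_of_mem_tail hy)
  subst this
  exact hq'.1 hy

theorem aux_prefix {V : Type*} {G : SimpleGraph V} {u v w x : V}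
    (R : G.Walk u v) (P : G.Walk w x) (hP : P.IsPath) (h : R.IsPrefixOf P) (z : V)
    (hz : z ∈ R.support) : ∃ (s t : V) (L : G.Walk s z) (T : G.Walk z t), L.IsPath ∧ T.IsPath ∧
      L.length + T.length = P.length ∧ (∀ y ∈ L.support, y ∈ P.support) ∧
      (∀ y ∈ T.support, y ∈ R.support) := by
  classical
  obtain ⟨rfl, Q, rfl⟩ := h
  simp only [Walk.copy_rfl_rfl] at *
  have hz' : z ∈ (R.append Q).support := by simp [hz]
  have hR := hP.of_append_left
  refine ⟨_, _, ((R.append Q).dropUntil z hz').reverse, (R.takeUntil z hz).reverse,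
    (hP.dropUntil hz').reverse, (hR.takeUntil hz).reverse, ?_, ?_, ?_⟩
  · have h1 := congrArg Walk.length ((R.append Q).take_spec hz')
    rw [Walk.takeUntil_append_of_mem_left _ _ hz, Walk.length_append] at h1
    simp only [Walk.length_reverse]
    omega
  · intro y hy
    rw [Walk.support_reverse, List.mem_reverse] at hy
    exact Walk.support_dropUntil_subset _ _ hy
  · intro y hy
    rw [Walk.support_reverse, List.mem_reverse] at hy
    exact Walk.support_takeUntil_subset _ _ hy

theorem aux_suffix {V : Type*} {G : SimpleGraph V} {u v w x : V}
    (R : G.Walk u v) (P : G.Walk w x) (h : R.IsSuffixOf P) :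
    R.reverse.IsPrefixOf P.reverse := by
  obtain ⟨rfl, Q, rfl⟩ := h
  exact ⟨rfl, Q.reverse, by simp [Walk.reverse_append]⟩

theorem aux_tail {V : Type*} {G : SimpleGraph V} {u v w x : V}
    (R : G.Walk u v) (P : G.Walk w x) (hP : P.IsPath) (h : R.IsTailOf P) (z : V)
    (hz : z ∈ R.support) : ∃ (s t : V) (L : G.Walk s z) (T : G.Walk z t), L.IsPath ∧ T.IsPath ∧
      L.length + T.length = P.length ∧ (∀ y ∈ L.support, y ∈ P.support) ∧
      (∀ y ∈ T.support, y ∈ R.support) := by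
  rcases h with h | h | h | h
  · exact aux_prefix R P hP h z hz
  · simpa using aux_prefix _ _ hP.reverse (aux_suffix _ _ h) z (by simpa using hz)
  · simpa using aux_prefix _ _ hP h z (by simpa using hz)
  · simpa using aux_prefix _ _ hP.reverse (aux_suffix _ _ h) z (by simpa using hz)

theorem aux_conn {V : Type*} {G : SimpleGraph V} {e f : V} (P : G.Walk e f) (A B : V → Prop)
    (hA : ∃ v, v ∈ P.support ∧ A v) (hB : ∃ v, v ∈ P.support ∧ B v) :
    ∃ (x y : V) (Q : G.Walk x y), Q.IsPath ∧ A x ∧ B y ∧ (∀ z ∈ Q.support, z ∈ P.support) ∧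
      (∀ z ∈ Q.support, A z → z = x) ∧ (∀ z ∈ Q.support, B z → z = y) := by
  classical
  have hex : ∃ n, ∃ (x y : V) (Q : G.Walk x y), A x ∧ B y ∧ (∀ z ∈ Q.support, z ∈ P.support) ∧
      Q.length = n := by
    obtain ⟨x, hx, hAx⟩ := hA
    obtain ⟨y, hy, hBy⟩ := hB
    refine ⟨_, x, y, (P.takeUntil x hx).reverse.append (P.takeUntil y hy), hAx, hBy, ?_, rfl⟩
    intro z hz
    rw [Walk.mem_support_append_iff, Walk.support_reverse, List.mem_reverse] at hz
    rcases hz with hz | hz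
    · exact Walk.support_takeUntil_subset _ _ hz
    · exact Walk.support_takeUntil_subset _ _ hz
  obtain ⟨x, y, Q, hAx, hBy, hQ, hlen⟩ := Nat.find_spec hex
  have hmin : ∀ (x' y' : V) (Q' : G.Walk x' y'), A x' → B y' →
      (∀ z ∈ Q'.support, z ∈ P.support) → Q.length ≤ Q'.length := by
    intro x' y' Q' h1 h2 h3
    rw [hlen]
    exact Nat.find_min' hex ⟨x', y', Q', h1, h2, h3, rfl⟩
  have hsub : ∀ z ∈ Q.bypass.support, z ∈ P.support := fun z hz =>
    hQ z (Walk.support_bypass_subset _ hz)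
  have hle := Walk.length_bypass_le Q
  refine ⟨x, y, Q.bypass, Q.bypass_isPath, hAx, hBy, hsub, ?_, ?_⟩
  · intro z hz hAz
    have h1 := hmin _ _ (Q.bypass.dropUntil z hz) hAz hBy
      (fun w hw => hsub w (Walk.support_dropUntil_subset _ _ hw))
    have h2 := congrArg Walk.length (Q.bypass.take_spec hz)
    rw [Walk.length_append] at h2
    exact (Walk.eq_of_length_eq_zero (p := Q.bypass.takeUntil z hz) (by omega)).symm
  · intro z hz hBz
    have h1 := hmin _ _ (Q.bypass.takeUntil z hz) hAx hBz
      (fun w hw => hsub w (Walk.support_takeUntil_subset _ _ hw))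
    have h2 := congrArg Walk.length (Q.bypass.take_spec hz)
    rw [Walk.length_append] at h2
    exact Walk.eq_of_length_eq_zero (p := Q.bypass.dropUntil z hz) (by omega)

theorem aux_three {V : Type*} {G : SimpleGraph V} {s x y t : V} (A B : V → Prop)
    (L : G.Walk s x) (Q : G.Walk x y) (T : G.Walk y t)
    (hL : L.IsPath) (hQ : Q.IsPath) (hT : T.IsPath)
    (hLA : ∀ z ∈ L.support, A z) (hTB : ∀ z ∈ T.support, B z) (hTA : ∀ z ∈ T.support, ¬ A z)
    (hQA : ∀ z ∈ Q.support, A z → z = x) (hQB : ∀ z ∈ Q.support, B z → z = y) :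
    (L.append (Q.append T)).IsPath := by
  refine aux_append _ _ hL (aux_append _ _ hQ hT fun z h1 h2 => hQB z h1 (hTB z h2)) ?_
  intro z h1 h2
  rw [Walk.mem_support_append_iff] at h2
  rcases h2 with h2 | h2
  · exact hQA z h2 (hLA z h1)
  · exact absurd (hLA z h1) (hTA z h2)

/-- Two paths `P₁`, `P₂` with tails `R₁`, `R₂` such that `R₁` is disjoint from `P₂` and
`R₂` is disjoint from `P₁` cannot both be longest paths if there is a connecting path `P`
meeting `P₁` in a nonempty set of vertices inside `R₁` and meeting `P₂` in a nonempty set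
of vertices inside `R₂`. -/
theorem not_both_longest_of_connecting_path {V : Type} [Fintype V] {G : SimpleGraph V}
    {a₁ b₁ a₂ b₂ c₁ d₁ c₂ d₂ e f : V}
    (P₁ : G.Walk a₁ b₁) (P₂ : G.Walk a₂ b₂) (hP₁ : P₁.IsPath) (hP₂ : P₂.IsPath)
    (R₁ : G.Walk c₁ d₁) (R₂ : G.Walk c₂ d₂)
    (hR₁ : R₁.IsTailOf P₁) (hR₂ : R₂.IsTailOf P₂)
    (hdisj₁ : ∀ v ∈ R₁.support, v ∉ P₂.support)
    (hdisj₂ : ∀ v ∈ R₂.support, v ∉ P₁.support)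
    (P : G.Walk e f) (hP : P.IsPath)
    (hne₁ : ∃ v, v ∈ P.support ∧ v ∈ P₁.support)
    (hsub₁ : ∀ v, v ∈ P.support → v ∈ P₁.support → v ∈ R₁.support)
    (hne₂ : ∃ v, v ∈ P.support ∧ v ∈ P₂.support)
    (hsub₂ : ∀ v, v ∈ P.support → v ∈ P₂.support → v ∈ R₂.support) :
    ¬ (IsLongestPath G P₁ ∧ IsLongestPath G P₂) := by
  rintro ⟨⟨-, hl₁⟩, ⟨-, hl₂⟩⟩
  obtain ⟨x, y, Q, hQ, hx, hy, hQP, hQ₁, hQ₂⟩ :=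
    aux_conn P (· ∈ P₁.support) (· ∈ P₂.support) hne₁ hne₂
  have hxR := hsub₁ x (hQP x Q.start_mem_support) hx
  have hyR := hsub₂ y (hQP y Q.end_mem_support) hy
  have hpos : Q.length ≠ 0 := by
    intro h0
    have hxy := Walk.eq_of_length_eq_zero h0
    subst hxy
    exact hdisj₁ x hxR hy
  have hR₁P : ∀ z ∈ R₁.support, z ∈ P₁.support := by
    rcases hR₁ with ⟨rfl, W, rfl⟩ | ⟨rfl, W, rfl⟩ | ⟨rfl, W, rfl⟩ | ⟨rfl, W, rfl⟩ <;>
      intro z hz <;> simp [Walk.mem_support_append_iff, hz]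
  have hR₂P : ∀ z ∈ R₂.support, z ∈ P₂.support := by
    rcases hR₂ with ⟨rfl, W, rfl⟩ | ⟨rfl, W, rfl⟩ | ⟨rfl, W, rfl⟩ | ⟨rfl, W, rfl⟩ <;>
      intro z hz <;> simp [Walk.mem_support_append_iff, hz]
  obtain ⟨s₁, t₁, L₁, T₁, hL₁, hT₁, hlen₁, hLP₁, hTR₁⟩ := aux_tail R₁ P₁ hP₁ hR₁ x hxR
  obtain ⟨s₂, t₂, L₂, T₂, hL₂, hT₂, hlen₂, hLP₂, hTR₂⟩ := aux_tail R₂ P₂ hP₂ hR₂ y hyR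
  have hA := aux_three (· ∈ P₁.support) (· ∈ P₂.support) L₁ Q T₂ hL₁ hQ hT₂ hLP₁
    (fun z hz => hR₂P z (hTR₂ z hz)) (fun z hz => hdisj₂ z (hTR₂ z hz)) hQ₁ hQ₂
  have hB := aux_three (· ∈ P₂.support) (· ∈ P₁.support) L₂ Q.reverse T₁ hL₂ hQ.reverse hT₁ hLP₂
    (fun z hz => hR₁P z (hTR₁ z hz)) (fun z hz => hdisj₁ z (hTR₁ z hz))
    (by simpa using hQ₂) (by simpa using hQ₁)
  have h1 := hl₁ _ _ _ hA
  have h2 := hl₂ _ _ _ hB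
  simp only [Walk.length_append, Walk.length_reverse] at h1 h2
  omega
end

section
/- Let G be a finite connected series-parallel graph, let T be a 2-tree on the same vertex set containing G as a spanning subgraph, let Δ = {v1, v2, v3} be a triangle of T, and let {i,j,k} = {1,2,3}. Let R be a path in G with endpoint v_i whose vertex intersection with Δ equals {v_i}, let S1 be a path in G with endpoints v_i and v_j whose vertex intersection with Δ equals {v_i, v_j}, and let S2 be a path in G with endpoints v_j and v_k whose vertex intersection with Δ equals {v_j, v_k}. Then R and S2 are vertex-disjoint, and the vertex intersection of S1 and S2 equals {v_j}. -/
open SimpleGraph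

/-- The graph obtained from `G` by adding one new vertex adjacent exactly to `x` and `y`. -/
def SimpleGraph.addLink2 {V : Type u} (G : SimpleGraph V) (x y : V) :
    SimpleGraph (Option V) :=
  SimpleGraph.fromRel (fun a b =>
    (∃ u w : V, a = some u ∧ b = some w ∧ G.Adj u w) ∨
    (a = none ∧ (b = some x ∨ b = some y)))

/-- Skeletons of 2-trees: `K₂` is a 2-tree, and adding a new vertex adjacent exactly to the
two endpoints of an edge of a 2-tree yields a 2-tree. -/
inductive IsTwoTreeSkel : (W : Type u) → SimpleGraph W → Prop
  | base : IsTwoTreeSkel (ULift (Fin 2)) ⊤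
  | extend {W : Type u} {G : SimpleGraph W} {x y : W} :
      IsTwoTreeSkel W G → G.Adj x y → IsTwoTreeSkel (Option W) (G.addLink2 x y)

/-- A graph is a 2-tree if it is isomorphic to a 2-tree skeleton. -/
def IsTwoTree {V : Type u} (G : SimpleGraph V) : Prop :=
  ∃ (W : Type u) (H : SimpleGraph W), IsTwoTreeSkel W H ∧ Nonempty (G ≃g H)

theorem addLink2_some_some {V : Type u} (G : SimpleGraph V) (x y u w : V) :
    (G.addLink2 x y).Adj (some u) (some w) ↔ G.Adj u w := by
  simp only [SimpleGraph.addLink2, SimpleGraph.fromRel_adj]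
  constructor
  · rintro ⟨_, h⟩
    simpa [G.adj_comm w u] using h
  · intro h
    simp [h, h.ne]

theorem addLink2_none_some {V : Type u} (G : SimpleGraph V) (x y u : V) :
    (G.addLink2 x y).Adj none (some u) ↔ (u = x ∨ u = y) := by
  simp [SimpleGraph.addLink2, SimpleGraph.fromRel_adj]

theorem addLink2_some_none {V : Type u} (G : SimpleGraph V) (x y u : V) :
    (G.addLink2 x y).Adj (some u) none ↔ (u = x ∨ u = y) := by
  rw [SimpleGraph.adj_comm, addLink2_none_some]

/-- Each triangle admits a labelling of the vertices off it, constant along edges, by a triangle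
vertex to which they are not adjacent. -/
def TriLabel {V : Type u} (T : SimpleGraph V) : Prop :=
  ∀ a b c : V, T.Adj a b → T.Adj a c → T.Adj b c → ∃ f : V → V,
    (∀ x, f x = a ∨ f x = b ∨ f x = c) ∧
    (∀ x, x ≠ a → x ≠ b → x ≠ c → ¬ T.Adj x (f x)) ∧
    (∀ x y, x ≠ a → x ≠ b → x ≠ c → y ≠ a → y ≠ b → y ≠ c → T.Adj x y → f x = f y)

theorem triLabel_addLink2 {W : Type u} {G : SimpleGraph W} {x y : W} (hG : TriLabel G)
    (hxy : G.Adj x y) : TriLabel (G.addLink2 x y) := by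
  classical
  intro a b c hab hac hbc
  have hne := hxy.ne
  have key : (a = none ∨ b = none ∨ c = none) → ∃ f : Option W → Option W,
      (∀ x, f x = a ∨ f x = b ∨ f x = c) ∧
      (∀ z, z ≠ a → z ≠ b → z ≠ c → ¬ (G.addLink2 x y).Adj z (f z)) ∧
      (∀ z w, z ≠ a → z ≠ b → z ≠ c → w ≠ a → w ≠ b → w ≠ c →
        (G.addLink2 x y).Adj z w → f z = f w) := by
    intro h
    refine ⟨fun _ => none, by grind, ?_, by simp⟩
    intro z za zb zc hz
    have h1 := hab.ne
    have h2 := hac.ne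
    have h3 := hbc.ne
    rcases a with _ | a <;> rcases b with _ | b <;> rcases c with _ | c <;>
      rcases z with _ | z <;>
      simp_all [addLink2_none_some, addLink2_some_none, addLink2_some_some] <;> grind
  by_cases h : a = none ∨ b = none ∨ c = none
  · exact key h
  obtain ⟨a, rfl⟩ : ∃ a', a = some a' := by cases a <;> simp_all
  obtain ⟨b, rfl⟩ : ∃ a', b = some a' := by cases b <;> simp_all
  obtain ⟨c, rfl⟩ : ∃ a', c = some a' := by cases c <;> simp_all
  rw [addLink2_some_some] at hab hac hbc
  obtain ⟨f, h1, h2, h3⟩ := hG a b c hab hac hbc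
  have n1 := hab.ne
  have n2 := hac.ne
  have n3 := hbc.ne
  have hyx := hxy.symm
  -- label of the new vertex
  obtain ⟨l, l1, l2, l3⟩ : ∃ l : W, (l = a ∨ l = b ∨ l = c) ∧ (l ≠ x ∧ l ≠ y) ∧
      (∀ w, w ≠ a → w ≠ b → w ≠ c → (w = x ∨ w = y) → f w = l) := by
    by_cases hx : x ≠ a ∧ x ≠ b ∧ x ≠ c
    · refine ⟨f x, h1 x, ⟨by grind, ?_⟩, ?_⟩
      · intro e
        exact h2 x hx.1 hx.2.1 hx.2.2 (e ▸ hxy)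
      · rintro w wa wb wc (rfl | rfl)
        · rfl
        · exact h3 _ _ wa wb wc hx.1 hx.2.1 hx.2.2 hyx
    · by_cases hy : y ≠ a ∧ y ≠ b ∧ y ≠ c
      · refine ⟨f y, h1 y, ⟨?_, by grind⟩, by grind⟩
        intro e
        exact h2 y hy.1 hy.2.1 hy.2.2 (e ▸ hyx)
      · have : ∃ l : W, (l = a ∨ l = b ∨ l = c) ∧ (l ≠ x ∧ l ≠ y) := by
          by_cases ha : a ≠ x ∧ a ≠ y
          · exact ⟨a, by simp, ha⟩
          by_cases hb : b ≠ x ∧ b ≠ y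
          · exact ⟨b, by simp, hb⟩
          exact ⟨c, by simp, by grind⟩
        obtain ⟨l, hl, hl'⟩ := this
        exact ⟨l, hl, hl', by grind⟩
  refine ⟨fun o => some (o.elim l f), ?_, ?_, ?_⟩
  · rintro (_ | z)
    · simpa using l1
    · simpa using h1 z
  · rintro (_ | z) za zb zc
    · simpa [addLink2_none_some] using l2
    · simpa [addLink2_some_some] using h2 z (by simpa using za) (by simpa using zb)
        (by simpa using zc)
  · rintro (_ | z) (_ | w) za zb zc wa wb wc hzw
    · rfl
    · rw [addLink2_none_some] at hzw
      simpa using (l3 w (by simpa using wa) (by simpa using wb) (by simpa using wc) hzw).symm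
    · rw [addLink2_some_none] at hzw
      simpa using (l3 z (by simpa using za) (by simpa using zb) (by simpa using zc) hzw)
    · rw [addLink2_some_some] at hzw
      simpa using h3 z w (by simpa using za) (by simpa using zb) (by simpa using zc)
        (by simpa using wa) (by simpa using wb) (by simpa using wc) hzw

theorem triLabel_of_skel {W : Type u} {H : SimpleGraph W} (h : IsTwoTreeSkel W H) :
    TriLabel H := by
  induction h with
  | base =>
    rintro ⟨a⟩ ⟨b⟩ ⟨c⟩ hab hac hbc
    exfalso
    simp at hab hac hbc
    omega
  | extend _ hxy ih => exact triLabel_addLink2 ih hxy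

theorem triLabel_of_twoTree {V : Type u} {T : SimpleGraph V} (h : IsTwoTree T) :
    TriLabel T := by
  obtain ⟨W, H, hH, ⟨e⟩⟩ := h
  intro a b c hab hac hbc
  obtain ⟨f, h1, h2, h3⟩ := triLabel_of_skel hH (e a) (e b) (e c)
    (e.map_adj_iff.2 hab) (e.map_adj_iff.2 hac) (e.map_adj_iff.2 hbc)
  have inj : ∀ p q, p ≠ q → e p ≠ e q := fun p q h => e.injective.ne h
  refine ⟨fun v => e.symm (f (e v)), ?_, ?_, ?_⟩
  · intro z
    rcases h1 (e z) with h | h | h <;> simp [h]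
  · intro z za zb zc hz
    apply h2 (e z) (inj _ _ za) (inj _ _ zb) (inj _ _ zc)
    have := e.map_adj_iff.2 hz
    simpa using this
  · intro z w za zb zc wa wb wc hzw
    have := h3 (e z) (e w) (inj _ _ za) (inj _ _ zb) (inj _ _ zc) (inj _ _ wa) (inj _ _ wb)
      (inj _ _ wc) (e.map_adj_iff.2 hzw)
    simp [this]

theorem label_ne_of_walk {V : Type u} {G : SimpleGraph V} {f : V → V} {a b c : V}
    (h2 : ∀ x, x ≠ a → x ≠ b → x ≠ c → ¬ G.Adj x (f x))
    (h3 : ∀ x y, x ≠ a → x ≠ b → x ≠ c → y ≠ a → y ≠ b → y ≠ c → G.Adj x y → f x = f y)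
    {v d : V} (p : G.Walk v d) (hd : d = a ∨ d = b ∨ d = c)
    (ha : a ∈ p.support → a = d) (hb : b ∈ p.support → b = d) (hc : c ∈ p.support → c = d)
    (va : v ≠ a) (vb : v ≠ b) (vc : v ≠ c) : f v ≠ d := by
  induction p with
  | nil => grind
  | @cons v u d h p ih =>
    simp only [SimpleGraph.Walk.support_cons, List.mem_cons] at ha hb hc
    by_cases hu : u ≠ a ∧ u ≠ b ∧ u ≠ c
    · rw [h3 v u va vb vc hu.1 hu.2.1 hu.2.2 h]
      exact ih hd (fun h => ha (Or.inr h)) (fun h => hb (Or.inr h)) (fun h => hc (Or.inr h))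
        hu.1 hu.2.1 hu.2.2
    · have hs : u ∈ p.support := p.start_mem_support
      have : u = d := by grind
      subst this
      intro e
      exact h2 v va vb vc (e ▸ h)

/-- Let `G` be a connected series-parallel graph, spanning subgraph of a 2-tree `T`, with a
triangle `{v₁, v₂, v₃}` of `T`.  Let `R` be a path of `G` with endpoint `v₁` meeting the
triangle only in `v₁`, `S₁` a path from `v₁` to `v₂` meeting the triangle only in
`{v₁, v₂}`, and `S₂` a path from `v₂` to `v₃` meeting the triangle only in `{v₂, v₃}`.
Then `R` and `S₂` are vertex-disjoint, and `S₁ ∩ S₂ = {v₂}`. -/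
theorem disjointness_around_triangle {V : Type} [Fintype V] (G T : SimpleGraph V)
    (hGT : G ≤ T) (hT : IsTwoTree T) (hconn : G.Connected)
    (v₁ v₂ v₃ : V) (h12 : v₁ ≠ v₂) (h13 : v₁ ≠ v₃) (h23 : v₂ ≠ v₃)
    (hadj12 : T.Adj v₁ v₂) (hadj13 : T.Adj v₁ v₃) (hadj23 : T.Adj v₂ v₃)
    {t : V} (R : G.Walk v₁ t) (hR : R.IsPath)
    (hRΔ : v₂ ∉ R.support ∧ v₃ ∉ R.support)
    (S₁ : G.Walk v₁ v₂) (hS₁ : S₁.IsPath) (hS₁Δ : v₃ ∉ S₁.support)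
    (S₂ : G.Walk v₂ v₃) (hS₂ : S₂.IsPath) (hS₂Δ : v₁ ∉ S₂.support) :
    (∀ v ∈ R.support, v ∉ S₂.support) ∧
    {v : V | v ∈ S₁.support ∧ v ∈ S₂.support} = {v₂} := by
  classical
  obtain ⟨f, h1, h2, h3⟩ := triLabel_of_twoTree hT v₁ v₂ v₃ hadj12 hadj13 hadj23
  have g2 : ∀ x, x ≠ v₁ → x ≠ v₂ → x ≠ v₃ → ¬ G.Adj x (f x) :=
    fun x a b c h => h2 x a b c (hGT h)
  have g3 : ∀ x y, x ≠ v₁ → x ≠ v₂ → x ≠ v₃ → y ≠ v₁ → y ≠ v₂ → y ≠ v₃ → G.Adj x y →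
      f x = f y := fun x y a b c d e g h => h3 x y a b c d e g (hGT h)
  -- a vertex of `S₂` off the triangle carries the label `v₁`
  have hlab : ∀ v ∈ S₂.support, v ≠ v₁ → v ≠ v₂ → v ≠ v₃ → f v = v₁ := by
    intro v hv n1 n2 n3
    have e3 : f v ≠ v₃ := by
      have hn : v₂ ∉ (S₂.dropUntil v hv).support := by
        intro hm
        have hv' : v ∈ S₂.reverse.support := by simpa using hv
        have hp := hS₂
        rw [← S₂.take_spec hv, SimpleGraph.Walk.isPath_def,
          SimpleGraph.Walk.support_append] at hp
        have hm' : v₂ ∈ (S₂.dropUntil v hv).support.tail := by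
          rw [SimpleGraph.Walk.mem_support_iff] at hm
          rcases hm with h | h
          · exact absurd h.symm n2
          · exact h
        exact (List.nodup_append.1 hp).2.2 _ (SimpleGraph.Walk.start_mem_support _) _ hm' rfl
      refine label_ne_of_walk g2 g3 (S₂.dropUntil v hv) (by simp) ?_ (fun h => absurd h hn)
        (fun _ => rfl) n1 n2 n3
      exact fun h => absurd (S₂.support_dropUntil_subset_support hv h) hS₂Δ
    have e2 : f v ≠ v₂ := by
      have hn : v₃ ∉ (S₂.takeUntil v hv).support :=
        SimpleGraph.Walk.endpoint_notMem_support_takeUntil hS₂ hv n3.symm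
      refine label_ne_of_walk g2 g3 (S₂.takeUntil v hv).reverse (by simp) ?_ (fun _ => rfl)
        ?_ n1 n2 n3
      · intro h
        rw [SimpleGraph.Walk.support_reverse, List.mem_reverse] at h
        exact absurd (S₂.support_takeUntil_subset_support hv h) hS₂Δ
      · intro h
        rw [SimpleGraph.Walk.support_reverse, List.mem_reverse] at h
        exact absurd h hn
    rcases h1 v with h | h | h
    · exact h
    · exact absurd h e2
    · exact absurd h e3
  constructor
  · intro v hv hv2
    have n1 : v ≠ v₁ := fun h => hS₂Δ (h ▸ hv2)
    have n2 : v ≠ v₂ := fun h => hRΔ.1 (h ▸ hv)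
    have n3 : v ≠ v₃ := fun h => hRΔ.2 (h ▸ hv)
    refine label_ne_of_walk g2 g3 (R.takeUntil v hv).reverse (by simp) (fun _ => rfl) ?_ ?_
      n1 n2 n3 (hlab v hv2 n1 n2 n3)
    · intro h
      rw [SimpleGraph.Walk.support_reverse, List.mem_reverse] at h
      exact absurd (R.support_takeUntil_subset_support hv h) hRΔ.1
    · intro h
      rw [SimpleGraph.Walk.support_reverse, List.mem_reverse] at h
      exact absurd (R.support_takeUntil_subset_support hv h) hRΔ.2
  · ext v
    simp only [Set.mem_ofPred_eq, Set.mem_singleton_iff]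
    constructor
    · rintro ⟨hv, hv2⟩
      by_contra n2
      have n1 : v ≠ v₁ := fun h => hS₂Δ (h ▸ hv2)
      have n3 : v ≠ v₃ := fun h => hS₁Δ (h ▸ hv)
      refine label_ne_of_walk g2 g3 (S₁.takeUntil v hv).reverse (by simp) (fun _ => rfl) ?_ ?_
        n1 n2 n3 (hlab v hv2 n1 n2 n3)
      · intro h
        rw [SimpleGraph.Walk.support_reverse, List.mem_reverse] at h
        exact absurd h (SimpleGraph.Walk.endpoint_notMem_support_takeUntil hS₁ hv (Ne.symm n2))
      · intro h
        rw [SimpleGraph.Walk.support_reverse, List.mem_reverse] at h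
        exact absurd (S₁.support_takeUntil_subset_support hv h) hS₁Δ
    · rintro rfl
      exact ⟨S₁.end_mem_support, S₂.start_mem_support⟩
end
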